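/- arXiv:2509.00273 — 2 statements merged into one kernel-verified Lean document; each statement's English description precedes it below -/
import Mathlib

section
/- Let ℓ₁ ≠ ℓ₂ be odd primes and let p be a prime with gcd(p, 2ℓ₁ℓ₂) = 1. Suppose H_{ℓ₁} is maximal over 𝔽_{p^{2m}} and H_{ℓ₂} is maximal over 𝔽_{p^{2n}} for positive integers m, n, and suppose there exists a positive integer k such that H_{ℓ₁ℓ₂} is maximal over 𝔽_{p^{2k}}. Then m and n have the same 2-adic valuation. -/
open Polynomial

/-- Number of affine points (x,y) ∈ F × F with y² = φ_d(x), where φ_d is the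
d-th Chebyshev (Dickson first kind, parameter 1) polynomial over F. -/
noncomputable def chebAffineCount (F : Type) [Field F] (d : ℕ) : ℕ :=
  Nat.card {xy : F × F // xy.2 ^ 2 = (dickson 1 (1 : F) d).eval xy.1}

/-- The hyperelliptic curve H_d : y² = φ_d(x) is maximal over the field with q² elements:
its affine point count attains q² + (d-1)q (Hasse–Weil bound minus the point at infinity). -/
def chebMaximal (d q : ℕ) : Prop :=
  ∀ (F : Type) [Field F] [Fintype F], Fintype.card F = q ^ 2 →
    chebAffineCount F d = q ^ 2 + (d - 1) * q



/-- The quadratic character, with classical decidability. -/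
noncomputable def qc (F : Type) [Field F] [Fintype F] : MulChar F ℤ :=
  @quadraticChar F _ _ (Classical.decEq F)

lemma qc_sum_zero (F : Type) [Field F] [Fintype F] (hF : ringChar F ≠ 2) :
    ∑ a : F, qc F a = 0 := by
  classical
  have := quadraticChar_sum_zero hF
  unfold qc
  convert this

lemma qc_sq (F : Type) [Field F] [Fintype F] {a : F} (ha : a ≠ 0) : qc F a * qc F a = 1 := by
  have := @quadraticChar_sq_one F _ _ (Classical.decEq F) a ha
  unfold qc
  rw [← this, sq]

lemma qc_le (F : Type) [Field F] [Fintype F] (a : F) : qc F a * qc F a ≤ 1 := by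
  by_cases ha : a = 0
  · subst ha; rw [MulChar.map_zero]; norm_num
  · rw [qc_sq F ha]

lemma affineCount_eq (F : Type) [Field F] [Fintype F] (hF : ringChar F ≠ 2) (d : ℕ) :
    (chebAffineCount F d : ℤ) = Fintype.card F + ∑ x : F, qc F ((dickson 1 (1 : F) d).eval x) := by
  classical
  have e : {xy : F × F // xy.2 ^ 2 = (dickson 1 (1 : F) d).eval xy.1} ≃
      Σ x : F, {y : F // y ^ 2 = (dickson 1 (1 : F) d).eval x} :=
    { toFun := fun z => ⟨z.1.1, z.1.2, z.2⟩
      invFun := fun z => ⟨(z.1, z.2.1), z.2.2⟩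
      left_inv := fun _ => rfl
      right_inv := fun _ => rfl }
  have h1 : ∀ a : F, (Fintype.card {y : F // y ^ 2 = a} : ℤ) = qc F a + 1 := by
    intro a
    have := @quadraticChar_card_sqrts F _ _ (Classical.decEq F) hF a
    unfold qc
    rw [← this, Set.toFinset_card]
    rfl
  unfold chebAffineCount
  rw [Nat.card_congr e, Nat.card_eq_fintype_card, Fintype.card_sigma]
  push_cast
  simp_rw [h1]
  rw [Finset.sum_add_distrib]
  simp [add_comm]

lemma bilin_zero (F : Type) [Field F] [Fintype F] (hF : ringChar F ≠ 2) (V : Type) [Fintype V]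
    (hV : Fintype.card V = Fintype.card F ^ 2) (f : V → F × F) (hf : Function.Injective f) :
    ∑ v, qc F (f v).1 * qc F (f v).2 = 0 := by
  have hb : Function.Bijective f := by
    rw [Fintype.bijective_iff_injective_and_card]
    exact ⟨hf, by rw [hV, Fintype.card_prod, sq]⟩
  rw [Function.Bijective.sum_comp hb (fun z : F × F => qc F z.1 * qc F z.2),
    Fintype.sum_prod_type]
  simp_rw [← Finset.mul_sum]
  rw [← Finset.sum_mul, qc_sum_zero F hF, zero_mul]

/-- Sum over a group. -/
noncomputable def tor (F : Type) [Field F] [Fintype F] (G : Type) [CommGroup G] [Fintype G]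
    (f : G → F) (d : ℕ) : ℤ := ∑ t : G, qc F (f (t ^ d))

lemma fiber_card (G : Type) [CommGroup G] [Fintype G] [DecidableEq G] [IsCyclic G] (n : ℕ)
    (t0 : G) :
    (Finset.univ.filter (fun t : G => t ^ n = t0 ^ n)).card = (Fintype.card G).gcd n := by
  rw [← Nat.card_eq_fintype_card, ← IsCyclic.card_powMonoidHom_ker, Nat.card_eq_fintype_card,
    ← Fintype.card_coe]
  apply Fintype.card_congr
  refine ⟨fun t => ⟨t.1 * t0⁻¹, ?_⟩, fun t => ⟨t.1 * t0, ?_⟩, ?_, ?_⟩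
  · have := (Finset.mem_filter.1 t.2).2
    simp [MonoidHom.mem_ker, mul_pow, this]
  · have : t.1 ^ n = 1 := t.2
    simp [mul_pow, this]
  · intro t; simp
  · intro t; simp

lemma tor_coprime (F : Type) [Field F] [Fintype F] (G : Type) [CommGroup G] [Fintype G]
    (f : G → F) (d : ℕ) (h : (Fintype.card G).Coprime d) : tor F G f d = tor F G f 1 := by
  unfold tor
  rw [← Nat.card_eq_fintype_card] at h
  rw [Function.Bijective.sum_comp h.pow_left_bijective (fun t => qc F (f t))]
  simp

lemma tor_dvd (F : Type) [Field F] [Fintype F] (G : Type) [CommGroup G] [Fintype G] [IsCyclic G]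
    (f : G → F) (d l : ℕ) (hl : l ∣ Fintype.card G) (hd : l ∣ d) : (l : ℤ) ∣ tor F G f d := by
  classical
  unfold tor
  rw [Finset.sum_comp (fun s => qc F (f s)) (fun t : G => t ^ d)]
  apply Finset.dvd_sum
  intro b hb
  obtain ⟨t0, -, rfl⟩ := Finset.mem_image.1 hb
  rw [fiber_card G d t0]
  rw [nsmul_eq_mul]
  exact Dvd.dvd.mul_right (by exact_mod_cast Nat.dvd_gcd hl hd) _

lemma tor_bound (F : Type) [Field F] [Fintype F] (hF : ringChar F ≠ 2)
    (G : Type) [CommGroup G] [Fintype G] [IsCyclic G]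
    (V : Type) [Fintype V] (hV : Fintype.card V = Fintype.card F ^ 2)
    (A : G → V → F) (w : Fˣ → G → V) (f : G → F)
    (hA : ∀ s g h, A h (w s g) = s * f (h * g))
    (hinj : ∀ g h, g ^ 2 ≠ h ^ 2 → ∀ v v', A g v = A g v' → A h v = A h v' → v = v')
    (hw : ∀ s s' g g', w s g = w s' g' → g ^ 2 = g' ^ 2 ∧ (g = g' → s = s'))
    (d : ℕ) :
    (tor F G f d) ^ 2 * (Fintype.card F - 1) ≤
      ((Fintype.card G).gcd (2 * d) : ℤ) ^ 2 * (Fintype.card F) ^ 2 := by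
  classical
  set N := (Fintype.card G).gcd (2 * d) with hN
  set T := tor F G f d with hT
  let S : V → ℤ := fun v => ∑ t : G, qc F (A (t ^ d) v)
  -- second moment
  have hmom : ∑ v, S v ^ 2 ≤ Fintype.card G * N * (Fintype.card F : ℤ) ^ 2 := by
    have e1 : ∑ v, S v ^ 2 = ∑ t : G, ∑ u : G, ∑ v, qc F (A (t ^ d) v) * qc F (A (u ^ d) v) := by
      simp only [S, sq, Finset.sum_mul_sum]
      rw [Finset.sum_comm]
      refine Finset.sum_congr rfl fun t _ => ?_
      rw [Finset.sum_comm]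
    rw [e1]
    have e2 : ∀ t u : G, ∑ v, qc F (A (t ^ d) v) * qc F (A (u ^ d) v) ≤
        if u ^ (2 * d) = t ^ (2 * d) then (Fintype.card F : ℤ) ^ 2 else 0 := by
      intro t u
      split_ifs with h
      · calc _ ≤ ∑ v : V, (1 : ℤ) := by
              refine Finset.sum_le_sum fun v _ => ?_
              nlinarith [qc_le F (A (t ^ d) v), qc_le F (A (u ^ d) v),
                sq_nonneg (qc F (A (t ^ d) v) - qc F (A (u ^ d) v))]
          _ = _ := by simp [hV]
      · refine le_of_eq (bilin_zero F hF V hV (fun v => (A (t ^ d) v, A (u ^ d) v)) ?_)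
        intro v v' hv
        simp only [Prod.mk.injEq] at hv
        refine hinj (t ^ d) (u ^ d) ?_ v v' hv.1 hv.2
        rw [← pow_mul, ← pow_mul, mul_comm d 2]
        exact fun h' => h h'.symm
    calc _ ≤ ∑ t : G, ∑ u : G, if u ^ (2 * d) = t ^ (2 * d) then (Fintype.card F : ℤ) ^ 2 else 0 :=
          Finset.sum_le_sum fun t _ => Finset.sum_le_sum fun u _ => e2 t u
      _ = _ := by
          simp_rw [← Finset.sum_filter, Finset.sum_const, fiber_card G (2 * d), ← hN]
          simp [mul_assoc]
  -- lower bound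
  have hval : ∀ (s : Fˣ) (t : G), S (w s (t ^ d)) ^ 2 = T ^ 2 := by
    intro s t
    have : S (w s (t ^ d)) = qc F s * T := by
      simp only [S, hA, map_mul, ← Finset.mul_sum, ← mul_pow]
      congr 1
      rw [hT]
      unfold tor
      exact Fintype.sum_equiv (Equiv.mulRight t) _ _ (fun x => rfl)
    rw [this, mul_pow, sq (qc F s), qc_sq F s.ne_zero, one_mul]
  have hfib : ∀ v : V, ((Finset.univ : Finset (Fˣ × G)).filter
      (fun z => w z.1 (z.2 ^ d) = v)).card ≤ N := by
    intro v
    rcases Finset.eq_empty_or_nonempty ((Finset.univ : Finset (Fˣ × G)).filter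
      (fun z => w z.1 (z.2 ^ d) = v)) with h | ⟨z0, hz0⟩
    · rw [h]; simp
    · rw [hN, ← fiber_card G (2 * d) z0.2]
      simp only [Finset.mem_filter, Finset.mem_univ, true_and] at hz0
      refine Finset.card_le_card_of_injOn (fun z => z.2) ?_ ?_
      · intro z hz
        simp at hz
        have := (hw _ _ _ _ (hz.trans hz0.symm)).1
        simp only [Finset.coe_filter, Finset.mem_univ, true_and, Set.mem_setOf_eq]
        rw [← pow_mul, ← pow_mul, mul_comm d 2] at this
        exact this
      · intro z hz z' hz' hzz
        simp at hz hz' hzz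
        have := (hw _ _ _ _ (hz.trans hz'.symm)).2 (by rw [hzz])
        exact Prod.ext this hzz
  have hlow : (Fintype.card Fˣ * Fintype.card G : ℤ) * T ^ 2 ≤ N * ∑ v, S v ^ 2 := by
    calc _ = ∑ z : Fˣ × G, S (w z.1 (z.2 ^ d)) ^ 2 := by
          simp [hval]
      _ = ∑ v, ((Finset.univ : Finset (Fˣ × G)).filter
            (fun z => w z.1 (z.2 ^ d) = v)).card * S v ^ 2 := by
          rw [← Finset.sum_fiberwise_of_maps_to (s := Finset.univ) (t := Finset.univ)
            (g := fun z : Fˣ × G => w z.1 (z.2 ^ d)) (fun _ _ => Finset.mem_univ _)]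
          refine Finset.sum_congr rfl fun v _ => ?_
          rw [Finset.sum_congr rfl (g := fun _ => S v ^ 2)]
          · simp
          · intro z hz
            rw [(Finset.mem_filter.1 hz).2]
      _ ≤ ∑ v, (N : ℤ) * S v ^ 2 := by
          refine Finset.sum_le_sum fun v _ => ?_
          have := hfib v
          have h2 := sq_nonneg (S v)
          gcongr
      _ = _ := by rw [Finset.mul_sum]
  have hc : (Fintype.card Fˣ : ℤ) = Fintype.card F - 1 := by
    rw [Fintype.card_units, Nat.cast_sub Fintype.card_pos]; simp
  rw [hc] at hlow
  have hG : (0 : ℤ) < Fintype.card G := by exact_mod_cast Fintype.card_pos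
  have hN0 : (0 : ℤ) ≤ N := by positivity
  have := mul_le_mul_of_nonneg_left hmom hN0
  refine le_of_mul_le_mul_left ?_ hG
  nlinarith

/-- The norm one subgroup. -/
noncomputable def nOne (F L : Type) [Field F] [Field L] [Algebra F L] : Subgroup Lˣ :=
  (Units.map (Algebra.norm F (S := L))).ker

/-- trace on the split torus -/
def fS (F : Type) [Field F] (t : Fˣ) : F := t + ((t⁻¹ : Fˣ) : F)

/-- trace on the nonsplit torus -/
noncomputable def fN (F L : Type) [Field F] [Field L] [Algebra F L] (t : nOne F L) : F :=
  Algebra.trace F L ((t : Lˣ) : L)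

lemma tr_eq (F L : Type) [Field F] [Field L] [Fintype F] [Fintype L] [Algebra F L]
    (hr : Module.finrank F L = 2) (x : L) :
    algebraMap F L (Algebra.trace F L x) = x + x ^ Fintype.card F := by
  rw [FiniteField.algebraMap_trace_eq_sum_pow, hr]
  simp [Finset.sum_range_succ]

lemma nm_eq (F L : Type) [Field F] [Field L] [Fintype F] [Fintype L] [Algebra F L]
    (hr : Module.finrank F L = 2) (x : L) :
    algebraMap F L (Algebra.norm F x) = x * x ^ Fintype.card F := by
  rw [FiniteField.algebraMap_norm_eq_prod_pow, hr]
  simp [Finset.prod_range_succ]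

lemma nOne_norm (F L : Type) [Field F] [Field L] [Algebra F L] (t : nOne F L) :
    Algebra.norm F ((t : Lˣ) : L) = 1 := by
  have : Units.map (Algebra.norm F (S := L)) (t : Lˣ) = 1 := t.2
  have := congrArg (fun u : Fˣ => (u : F)) this
  simpa using this

lemma nOne_pow (F L : Type) [Field F] [Field L] [Fintype F] [Fintype L] [Algebra F L]
    (hr : Module.finrank F L = 2) (t : nOne F L) :
    ((t : Lˣ) : L) ^ Fintype.card F = ((t : Lˣ) : L)⁻¹ := by
  have := nm_eq F L hr ((t : Lˣ) : L)
  rw [nOne_norm, map_one] at this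
  exact eq_inv_of_mul_eq_one_right this.symm

lemma fN_eq (F L : Type) [Field F] [Field L] [Fintype F] [Fintype L] [Algebra F L]
    (hr : Module.finrank F L = 2) (t : nOne F L) :
    algebraMap F L (fN F L t) = ((t : Lˣ) : L) + ((t : Lˣ) : L)⁻¹ := by
  unfold fN
  rw [tr_eq F L hr, nOne_pow F L hr]

lemma card_nOne (F L : Type) [Field F] [Field L] [Fintype F] [Fintype L] [Algebra F L]
    (hr : Module.finrank F L = 2) [Fintype (nOne F L)] :
    Fintype.card (nOne F L) = Fintype.card F + 1 := by
  have h1 := Subgroup.card_mul_index (nOne F L)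
  have h2 : (nOne F L).index = Fintype.card F - 1 := by
    classical
    unfold nOne
    rw [Subgroup.index_ker, MonoidHom.range_eq_top.2 (FiniteField.unitsMap_norm_surjective F L),
      Subgroup.card_top, Nat.card_eq_fintype_card, Fintype.card_units]
  have h3 : Nat.card Lˣ = Fintype.card F ^ 2 - 1 := by
    classical
    rw [Nat.card_eq_fintype_card, Fintype.card_units, Module.card_eq_pow_finrank (K := F), hr]
  rw [h2, h3, Nat.card_eq_fintype_card] at h1
  have h4 : 1 < Fintype.card F := Fintype.one_lt_card
  obtain ⟨a, ha⟩ := Nat.exists_eq_add_of_lt h4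
  rw [ha] at h1 ⊢
  have h5 : (1 + a + 1) ^ 2 - 1 = (1 + a + 1 + 1) * (1 + a + 1 - 1) := by
    have : (1 + a + 1) ^ 2 = (1 + a + 1 + 1) * (1 + a) + 1 := by ring
    rw [this]; simp
  rw [h5] at h1
  exact Nat.eq_of_mul_eq_mul_right (by omega) h1

lemma split_bound (F : Type) [Field F] [Fintype F] (hF : ringChar F ≠ 2) [Fintype Fˣ] (d : ℕ) :
    (tor F Fˣ (fS F) d) ^ 2 * (Fintype.card F - 1) ≤
      ((Fintype.card Fˣ).gcd (2 * d) : ℤ) ^ 2 * (Fintype.card F) ^ 2 := by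
  refine tor_bound F hF Fˣ (F × F) (by rw [Fintype.card_prod, sq])
    (fun h v => v.1 * h + v.2 * ((h⁻¹ : Fˣ) : F)) (fun s g => ((s * g : F), s * ((g⁻¹ : Fˣ) : F)))
    (fS F) ?_ ?_ ?_ d
  · intro s g h
    simp only [fS, mul_inv, Units.val_mul]
    ring
  · rintro g h hgh ⟨a, b⟩ ⟨a', b'⟩ h1 h2
    simp only [Units.val_inv_eq_inv_val] at h1 h2
    have hg := g.ne_zero
    have hh := h.ne_zero
    field_simp at h1 h2
    have hne : (g : F) ^ 2 - (h : F) ^ 2 ≠ 0 := by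
      intro h0
      apply hgh
      ext
      push_cast
      linear_combination h0
    have ha : a = a' := by
      have : (a - a') * ((g : F) ^ 2 - (h : F) ^ 2) = 0 := by linear_combination h1 - h2
      exact sub_eq_zero.1 ((mul_eq_zero.1 this).resolve_right hne)
    subst ha
    have hb : b = b' := by linear_combination h1
    rw [hb]
  · intro s s' g g' h
    simp only [Prod.mk.injEq, Units.val_inv_eq_inv_val] at h
    obtain ⟨h1, h2⟩ := h
    have hg := g.ne_zero
    have hg' := g'.ne_zero
    have hs := s.ne_zero
    have hs' := s'.ne_zero
    field_simp at h2
    constructor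
    · ext
      push_cast
      have : (s : F) * s' * ((g : F) ^ 2 - g' ^ 2) = 0 := by
        linear_combination (s' * (g : F)) * h1 - s' * (g' : F) * h2
      rcases mul_eq_zero.1 this with h | h
      · exact absurd h (mul_ne_zero hs hs')
      · linear_combination h
    · rintro rfl
      ext
      exact mul_right_cancel₀ hg h1

lemma nonsplit_bound (F L : Type) [Field F] [Field L] [Fintype F] [Fintype L] [Algebra F L]
    (hr : Module.finrank F L = 2) (hF : ringChar F ≠ 2) [Fintype (nOne F L)] (d : ℕ) :
    (tor F (nOne F L) (fN F L) d) ^ 2 * (Fintype.card F - 1) ≤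
      ((Fintype.card (nOne F L)).gcd (2 * d) : ℤ) ^ 2 * (Fintype.card F) ^ 2 := by
  refine tor_bound F hF (nOne F L) L (by rw [Module.card_eq_pow_finrank (K := F), hr])
    (fun h v => Algebra.trace F L (v * ((h : Lˣ) : L))) (fun s g => (s : F) • ((g : Lˣ) : L))
    (fN F L) ?_ ?_ ?_ d
  · intro s g h
    simp only [fN]
    rw [smul_mul_assoc, map_smul, smul_eq_mul]
    congr 2
    push_cast
    ring
  · rintro g h hgh v v' h1 h2
    have key : ∀ g : nOne F L, Algebra.trace F L (v * ((g : Lˣ) : L)) =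
        Algebra.trace F L (v' * ((g : Lˣ) : L)) →
        (v - v') * ((g : Lˣ) : L) ^ 2 = - (v - v') ^ Fintype.card F := by
      intro g hg
      have h0 : Algebra.trace F L ((v - v') * ((g : Lˣ) : L)) = 0 := by
        rw [sub_mul, map_sub, hg, sub_self]
      have h1 := tr_eq F L hr ((v - v') * ((g : Lˣ) : L))
      rw [h0, map_zero, mul_pow, nOne_pow F L hr] at h1
      have hg0 : ((g : Lˣ) : L) ≠ 0 := Units.ne_zero _
      field_simp at h1
      linear_combination -h1
    have hne : ((g : Lˣ) : L) ^ 2 - ((h : Lˣ) : L) ^ 2 ≠ 0 := by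
      intro h0
      apply hgh
      ext
      push_cast
      linear_combination h0
    have : (v - v') * (((g : Lˣ) : L) ^ 2 - ((h : Lˣ) : L) ^ 2) = 0 := by
      linear_combination key g h1 - key h h2
    exact sub_eq_zero.1 ((mul_eq_zero.1 this).resolve_right hne)
  · intro s s' g g' h
    simp only [Algebra.smul_def] at h
    have hs : algebraMap F L s ≠ 0 := by simp
    constructor
    · have h1 := congrArg (Algebra.norm F) h
      rw [map_mul, map_mul, nOne_norm, nOne_norm, Algebra.norm_algebraMap, Algebra.norm_algebraMap,
        hr, mul_one, mul_one] at h1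
      have h2 := congrArg (algebraMap F L) h1
      rw [map_pow, map_pow] at h2
      ext
      push_cast
      have h3 := congrArg (fun x => x ^ 2) h
      simp only [mul_pow] at h3
      rw [← h2] at h3
      exact mul_left_cancel₀ (pow_ne_zero 2 hs) h3
    · rintro rfl
      ext
      exact (algebraMap F L).injective (mul_right_cancel₀ (Units.ne_zero _) h)

lemma quad_card (L : Type) [Field L] [DecidableEq L] (x : L) (s : Finset L)
    (hs : ∀ t ∈ s, t ≠ 0 ∧ t + t⁻¹ = x) :
    s.card ≤ 2 := by
  rcases s.eq_empty_or_nonempty with rfl | ⟨t, ht⟩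
  · simp
  · refine (Finset.card_le_card (t := {t, t⁻¹}) ?_).trans Finset.card_le_two
    intro u hu
    obtain ⟨h1, h2⟩ := hs t ht
    obtain ⟨h3, h4⟩ := hs u hu
    rw [← h4] at h2
    field_simp at h2
    have : (u - t) * (u * t - 1) = 0 := by linear_combination -h2
    simp only [Finset.mem_insert, Finset.mem_singleton]
    rcases mul_eq_zero.1 this with h | h
    · left; linear_combination h
    · right; field_simp; linear_combination h

lemma fiber_le (F L : Type) [Field F] [Field L] [Fintype F] [Fintype L] [Algebra F L]
    (hr : Module.finrank F L = 2) [Fintype Fˣ] [Fintype (nOne F L)] [DecidableEq F] (x : F) :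
    (Finset.univ.filter (fun t : Fˣ => fS F t = x)).card +
    (Finset.univ.filter (fun t : nOne F L => fN F L t = x)).card ≤ 2 := by
  classical
  set A := Finset.univ.filter (fun t : Fˣ => fS F t = x) with hA
  set B := Finset.univ.filter (fun t : nOne F L => fN F L t = x) with hB
  have memA : ∀ t ∈ A, algebraMap F L (t : F) + (algebraMap F L (t : F))⁻¹ = algebraMap F L x := by
    intro t ht
    rw [← (Finset.mem_filter.1 ht).2]
    simp [fS]
  have memB : ∀ t ∈ B, ((t : Lˣ) : L) + ((t : Lˣ) : L)⁻¹ = algebraMap F L x := by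
    intro t ht
    rw [← (Finset.mem_filter.1 ht).2, fN_eq F L hr]
  have cA : A.card ≤ 2 := by
    rw [← Finset.card_image_of_injective A (f := fun t : Fˣ => algebraMap F L (t : F))
      ((algebraMap F L).injective.comp Units.val_injective)]
    refine quad_card L (algebraMap F L x) _ ?_
    intro t ht
    obtain ⟨u, hu, rfl⟩ := Finset.mem_image.1 ht
    exact ⟨by simp, memA u hu⟩
  have cB : B.card ≤ 2 := by
    rw [← Finset.card_image_of_injective B (f := fun t : nOne F L => ((t : Lˣ) : L))
      (Units.val_injective.comp Subtype.val_injective)]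
    refine quad_card L (algebraMap F L x) _ ?_
    intro t ht
    obtain ⟨u, hu, rfl⟩ := Finset.mem_image.1 ht
    exact ⟨by simp, memB u hu⟩
  rcases A.eq_empty_or_nonempty with h | ⟨a, ha⟩
  · rw [h]; simpa using cB
  rcases B.eq_empty_or_nonempty with h | ⟨b, hb⟩
  · rw [h]; simpa using cA
  -- both nonempty
  have quad : ∀ u v : L, u ≠ 0 → v ≠ 0 → u + u⁻¹ = v + v⁻¹ → u = v ∨ u = v⁻¹ := by
    intro u v hu hv h
    field_simp at h
    have : (u - v) * (u * v - 1) = 0 := by linear_combination h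
    rcases mul_eq_zero.1 this with h | h
    · left; linear_combination h
    · right; field_simp; linear_combination h
  have cross : ∀ a ∈ A, ∀ b ∈ B, algebraMap F L (a : F) = ((b : Lˣ) : L) ∧
      ((b : Lˣ) : L)⁻¹ = ((b : Lˣ) : L) := by
    intro a ha b hb
    have h1 := quad _ _ (by simp) (by simp) ((memA a ha).trans (memB b hb).symm)
    have h2 := nOne_pow F L hr b
    have h3 : (algebraMap F L (a : F)) ^ Fintype.card F = algebraMap F L (a : F) := by
      rw [← map_pow, FiniteField.pow_card]
    have h4 : ((b : Lˣ) : L)⁻¹ = ((b : Lˣ) : L) := by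
      rcases h1 with h | h
      · rw [← h2, ← h, h3]
      · rw [h, inv_pow, h2, inv_inv] at h3
        exact h3.symm
    refine ⟨?_, h4⟩
    rcases h1 with h | h
    · exact h
    · rw [h, h4]
  have c1 : A.card ≤ 1 := by
    rw [Finset.card_le_one]
    intro u hu v hv
    ext
    apply (algebraMap F L).injective
    rw [(cross u hu b hb).1, (cross v hv b hb).1]
  have c2 : B.card ≤ 1 := by
    rw [Finset.card_le_one]
    intro u hu v hv
    ext
    rw [← (cross a ha u hu).1, ← (cross a ha v hv).1]
  omega

lemma torus_sum (F L : Type) [Field F] [Field L] [Fintype F] [Fintype L] [Algebra F L]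
    (hr : Module.finrank F L = 2) [Fintype Fˣ] [Fintype (nOne F L)] (g : F → ℤ) :
    2 * ∑ x, g x = ∑ t : Fˣ, g (fS F t) + ∑ t : nOne F L, g (fN F L t) := by
  classical
  have hcU : Fintype.card Fˣ = Fintype.card F - 1 := by
    rw [← Nat.card_eq_fintype_card, Nat.card_units, Nat.card_eq_fintype_card]
  have hpos : 0 < Fintype.card F := Fintype.card_pos
  have htot : ∑ x : F, ((Finset.univ.filter (fun t : Fˣ => fS F t = x)).card +
      (Finset.univ.filter (fun t : nOne F L => fN F L t = x)).card) = ∑ x : F, 2 := by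
    rw [Finset.sum_add_distrib, 
      ← Finset.card_eq_sum_card_fiberwise (f := fS F) (s := Finset.univ) (t := Finset.univ)
        (fun _ _ => by simp),
      ← Finset.card_eq_sum_card_fiberwise (f := fN F L) (s := Finset.univ) (t := Finset.univ)
        (fun _ _ => by simp)]
    simp only [Finset.card_univ, card_nOne F L hr, hcU, Finset.sum_const, smul_eq_mul]
    omega
  have hfib := (Finset.sum_eq_sum_iff_of_le (fun x _ => fiber_le F L hr x)).1 htot
  have e1 : ∑ t : Fˣ, g (fS F t) =
      ∑ x : F, ((Finset.univ.filter (fun t : Fˣ => fS F t = x)).card : ℤ) * g x := by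
    rw [← Finset.sum_fiberwise_of_maps_to (s := Finset.univ) (t := Finset.univ)
            (g := fS F) (fun _ _ => Finset.mem_univ _)]
    refine Finset.sum_congr rfl fun v _ => ?_
    rw [Finset.sum_congr rfl (g := fun _ => g v)]
    · simp
    · intro z hz
      rw [(Finset.mem_filter.1 hz).2]
  have e2 : ∑ t : nOne F L, g (fN F L t) =
      ∑ x : F, ((Finset.univ.filter (fun t : nOne F L => fN F L t = x)).card : ℤ) * g x := by
    rw [← Finset.sum_fiberwise_of_maps_to (s := Finset.univ) (t := Finset.univ)
            (g := fN F L) (fun _ _ => Finset.mem_univ _)]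
    refine Finset.sum_congr rfl fun v _ => ?_
    rw [Finset.sum_congr rfl (g := fun _ => g v)]
    · simp
    · intro z hz
      rw [(Finset.mem_filter.1 hz).2]
  rw [e1, e2, ← Finset.sum_add_distrib, Finset.mul_sum]
  refine Finset.sum_congr rfl fun x hx => ?_
  rw [← add_mul, ← Nat.cast_add, hfib x hx]
  simp

lemma cheb_sum (F L : Type) [Field F] [Field L] [Fintype F] [Fintype L] [Algebra F L]
    (hr : Module.finrank F L = 2) [Fintype Fˣ] [Fintype (nOne F L)] (d : ℕ) :
    2 * ∑ x : F, qc F ((dickson 1 (1 : F) d).eval x) =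
      tor F Fˣ (fS F) d + tor F (nOne F L) (fN F L) d := by
  rw [torus_sum F L hr]
  unfold tor
  congr 1
  · refine Finset.sum_congr rfl fun t _ => ?_
    congr 1
    simp only [fS]
    rw [dickson_one_one_eval_add_inv _ _ (by simp)]
    simp
  · refine Finset.sum_congr rfl fun t _ => ?_
    congr 1
    apply (algebraMap F L).injective
    rw [fN_eq F L hr, ← Polynomial.eval_map_apply, Polynomial.map_dickson, map_one, fN_eq F L hr,
      dickson_one_one_eval_add_inv _ _ (by simp)]
    simp

/-- Character sum of the curve `y^2 = x^3 + x`. -/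
noncomputable def eSum (F : Type) [Field F] [Fintype F] : ℤ := ∑ x : F, qc F (x ^ 3 + x)

lemma tor_split_one (F : Type) [Field F] [Fintype F] [Fintype Fˣ] :
    tor F Fˣ (fS F) 1 = eSum F := by
  classical
  unfold tor eSum
  rw [← Finset.sum_subset (Finset.subset_univ (Finset.univ.erase (0 : F)))]
  · refine Finset.sum_bij (fun t _ => (t : F)) ?_ ?_ ?_ ?_
    · intro t _; simp
    · intro a _ b _ h; exact Units.ext h
    · intro b hb
      exact ⟨Units.mk0 b (by simpa using hb), by simp, by simp⟩
    · intro t _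
      have : (t : F) ^ 3 + t = (t * t) * fS F (t ^ 1) := by
        simp only [fS, pow_one, Units.val_inv_eq_inv_val]
        have := t.ne_zero
        field_simp
      rw [this, map_mul, map_mul, qc_sq F t.ne_zero, one_mul]
  · intro x _ hx
    have : x = 0 := by simpa using hx
    subst this
    simp [MulChar.map_zero]

lemma card_units' (F : Type) [Field F] [Fintype F] [Fintype Fˣ] :
    Fintype.card Fˣ = Fintype.card F - 1 := by
  rw [← Nat.card_eq_fintype_card, Nat.card_units, Nat.card_eq_fintype_card]

lemma tor_nonsplit_one (F L : Type) [Field F] [Field L] [Fintype F] [Fintype L] [Algebra F L]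
    (hr : Module.finrank F L = 2) (hF : ringChar F ≠ 2) [Fintype (nOne F L)] :
    tor F (nOne F L) (fN F L) 1 = - eSum F := by
  classical
  have := cheb_sum F L hr 1
  rw [tor_split_one] at this
  simp only [dickson_one, eval_X] at this
  rw [qc_sum_zero F hF] at this
  linarith

lemma exists_quad (F : Type) [Field F] [Fintype F] :
    ∃ (L : Type) (_ : Field L) (_ : Fintype L) (_ : Algebra F L), Module.finrank F L = 2 := by
  obtain ⟨p, hp⟩ := CharP.exists F
  haveI : Fact p.Prime := ⟨CharP.char_is_prime F p⟩
  exact ⟨FiniteField.Extension F p 2, inferInstance, Fintype.ofFinite _, inferInstance,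
    FiniteField.finrank_extension F p 2⟩

lemma max_sum (F : Type) [Field F] [Fintype F] (hF : ringChar F ≠ 2) (d q : ℕ) (hd : 0 < d)
    (hq : Fintype.card F = q ^ 2) (hmax : chebMaximal d q) :
    ∑ x : F, qc F ((dickson 1 (1 : F) d).eval x) = (d - 1) * q := by
  have h1 := affineCount_eq F hF d
  rw [hmax F hq, hq] at h1
  push_cast [Nat.cast_sub hd] at h1
  simp at h1
  linarith

lemma cong_of_dvd (F : Type) [Field F] [Fintype F] (hF : ringChar F ≠ 2) (d q l : ℕ) (hd : Odd d)
    (hq : Fintype.card F = q ^ 2) (hmax : chebMaximal d q) (hl : l ∣ d)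
    (h : d ∣ q ^ 2 - 1 ∨ d ∣ q ^ 2 + 1) :
    ((eSum F : ℤ) : ZMod l) = 2 * (q : ZMod l) ^ 3 ∧ (q : ZMod l) ^ 4 = 1 := by
  classical
  obtain ⟨L, _, _, _, hr⟩ := exists_quad F
  have hs := max_sum F hF d q hd.pos hq hmax
  have hc := cheb_sum F L hr d
  rw [hs] at hc
  have hc1 := card_units' F
  have hc2 := card_nOne F L hr
  have hQ : 0 < q ^ 2 := by rw [← hq]; exact Fintype.card_pos
  rw [hq] at hc1 hc2
  have hld : ((d : ℕ) : ZMod l) = 0 := (ZMod.natCast_eq_zero_iff d l).2 hl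
  have hcop : ∀ a b : ℕ, (a = b + 2 ∨ b = a + 2) → d ∣ a → b.Coprime d := by
    intro a b hab hda
    rw [Nat.coprime_iff_gcd_eq_one]
    have h1 : b.gcd d ∣ b := Nat.gcd_dvd_left _ _
    have h2 : b.gcd d ∣ a := (Nat.gcd_dvd_right _ _).trans hda
    have h3 : b.gcd d ∣ 2 := by
      rcases hab with h | h
      · rw [h] at h2; exact (Nat.dvd_add_right h1).1 h2
      · rw [h] at h1 ⊢; rw [h] at h2; exact (Nat.dvd_add_right h2).1 h1
    have h4 : Odd (b.gcd d) := hd.of_dvd_nat (Nat.gcd_dvd_right _ _)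
    rcases (Nat.dvd_prime Nat.prime_two).1 h3 with h | h
    · exact h
    · rw [h] at h4; exact absurd h4 (by decide)
  have hcz := congrArg (fun z : ℤ => (z : ZMod l)) hc
  push_cast at hcz
  rw [hld] at hcz
  rcases h with h | h
  · have t1 := tor_dvd F Fˣ (fS F) d l (by rw [hc1]; exact hl.trans h) hl
    have t2 := tor_coprime F (nOne F L) (fN F L) d
      (by rw [hc2]; exact hcop _ _ (by omega) h)
    rw [tor_nonsplit_one F L hr hF] at t2
    rw [t2, (ZMod.intCast_zmod_eq_zero_iff_dvd _ l).2 t1] at hcz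
    have hq1 : (q : ZMod l) ^ 2 = 1 := by
      have := (ZMod.natCast_eq_zero_iff (q ^ 2 - 1) l).2 (hl.trans h)
      rw [Nat.cast_sub hQ] at this
      push_cast at this
      linear_combination this
    push_cast at hcz
    constructor
    · linear_combination hcz - 2 * q * hq1
    · linear_combination (q ^ 2 + 1) * hq1
  · have t1 := tor_dvd F (nOne F L) (fN F L) d l (by rw [hc2]; exact hl.trans h) hl
    have t2 := tor_coprime F Fˣ (fS F) d
      (by rw [hc1]; exact hcop _ _ (by omega) h)
    rw [tor_split_one] at t2
    rw [t2, (ZMod.intCast_zmod_eq_zero_iff_dvd _ l).2 t1] at hcz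
    have hq1 : (q : ZMod l) ^ 2 = -1 := by
      have := (ZMod.natCast_eq_zero_iff (q ^ 2 + 1) l).2 (hl.trans h)
      push_cast at this
      linear_combination this
    constructor
    · linear_combination - hcz - 2 * q * hq1
    · linear_combination (q ^ 2 - 1) * hq1

lemma prime_dvd (F : Type) [Field F] [Fintype F] (hF : ringChar F ≠ 2) (l q : ℕ) (hl : l.Prime)
    (hq : Fintype.card F = q ^ 2) (hmax : chebMaximal l q) :
    l ∣ q ^ 2 - 1 ∨ l ∣ q ^ 2 + 1 := by
  classical
  by_contra hcon
  push Not at hcon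
  obtain ⟨L, _, _, _, hr⟩ := exists_quad F
  have hs := max_sum F hF l q hl.pos hq hmax
  have hc := cheb_sum F L hr l
  rw [hs] at hc
  have hc1 := card_units' F
  have hc2 := card_nOne F L hr
  have hQ : 0 < q ^ 2 := by rw [← hq]; exact Fintype.card_pos
  have hq0 : q ≠ 0 := by rintro rfl; simp at hQ
  rw [hq] at hc1 hc2
  rw [tor_coprime F Fˣ (fS F) l (by
      rw [hc1]; exact ((Nat.Prime.coprime_iff_not_dvd hl).2 hcon.1).symm),
    tor_coprime F (nOne F L) (fN F L) l (by
      rw [hc2]; exact ((Nat.Prime.coprime_iff_not_dvd hl).2 hcon.2).symm),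
    tor_split_one, tor_nonsplit_one F L hr hF] at hc
  have : ((l : ℤ) - 1) * q = 0 := by linarith
  have h2 := hl.two_le
  rcases mul_eq_zero.1 this with h | h
  · omega
  · exact hq0 (by exact_mod_cast h)

lemma abs_of_bound (T e g q : ℤ) (hq : 3 ≤ q) (hg : 0 ≤ g) (hge : g ≤ 2 * e)
    (h : T ^ 2 * (q ^ 2 - 1) ≤ g ^ 2 * (q ^ 2) ^ 2) : T ≤ 3 * e * q := by
  have h9 : 9 ≤ q ^ 2 := by nlinarith
  have hg2 : g ^ 2 ≤ 4 * e ^ 2 := by nlinarith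
  have h1 : T ^ 2 * (8 * q ^ 2) ≤ 36 * e ^ 2 * q ^ 2 * q ^ 2 := by
    have : T ^ 2 * (8 * q ^ 2) ≤ T ^ 2 * (9 * (q ^ 2 - 1)) :=
      mul_le_mul_of_nonneg_left (by linarith) (sq_nonneg _)
    have h3 : g ^ 2 * (q ^ 2) ^ 2 ≤ 4 * e ^ 2 * (q ^ 2) ^ 2 :=
      mul_le_mul_of_nonneg_right hg2 (by positivity)
    nlinarith
  have h2 : 8 * T ^ 2 ≤ 36 * e ^ 2 * q ^ 2 := by
    have hp : 0 < q ^ 2 := by linarith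
    refine le_of_mul_le_mul_right ?_ hp
    linarith
  have he : 0 ≤ e := by linarith
  refine abs_le_of_sq_le_sq' ?_ (by positivity) |>.2
  nlinarith [sq_nonneg (e * q)]

lemma prod_dvd (F : Type) [Field F] [Fintype F] (hF : ringChar F ≠ 2) (a b q : ℕ) (ha : a.Prime)
    (hb : b.Prime) (hao : Odd a) (hbo : Odd b) (hab : a ≠ b) (hq3 : 3 ≤ q)
    (hq : Fintype.card F = q ^ 2) (hmax : chebMaximal (a * b) q) :
    a * b ∣ q ^ 2 - 1 ∨ a * b ∣ q ^ 2 + 1 := by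
  classical
  by_contra hcon
  push Not at hcon
  obtain ⟨L, _, _, _, hr⟩ := exists_quad F
  have hs := max_sum F hF (a * b) q (mul_pos ha.pos hb.pos) hq hmax
  have hc := cheb_sum F L hr (a * b)
  rw [hs] at hc
  have hc1 := card_units' F
  have hc2 := card_nOne F L hr
  have hQ : 0 < q ^ 2 := by rw [← hq]; exact Fintype.card_pos
  have b1 := split_bound F hF (a * b)
  have b2 := nonsplit_bound F L hr hF (a * b)
  rw [hq] at hc1 hc2 b1 b2
  rw [hc1] at b1
  rw [hc2] at b2
  push_cast at b1 b2
  have hg : ∀ n : ℕ, n.gcd (2 * (a * b)) ≤ 2 * n.gcd (a * b) := by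
    intro n
    refine (Nat.le_of_dvd ?_ (Nat.gcd_mul_right_dvd_mul_gcd n 2 (a * b))).trans ?_
    · exact mul_pos (Nat.gcd_pos_of_pos_right _ (by norm_num))
        (Nat.gcd_pos_of_pos_right _ (mul_pos ha.pos hb.pos))
    · exact Nat.mul_le_mul_right _ (Nat.le_of_dvd (by norm_num) (Nat.gcd_dvd_right _ _))
  set e1 := (q ^ 2 - 1).gcd (a * b) with he1
  set e2 := (q ^ 2 + 1).gcd (a * b) with he2
  have k1 := abs_of_bound _ e1 _ q (by exact_mod_cast hq3) (by positivity)
    (by exact_mod_cast hg (q ^ 2 - 1)) b1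
  have k2 := abs_of_bound _ e2 _ q (by exact_mod_cast hq3) (by positivity)
    (by exact_mod_cast hg (q ^ 2 + 1)) b2
  have hcop : Nat.Coprime e1 e2 := by
    rw [Nat.coprime_iff_gcd_eq_one]
    have g1 : e1.gcd e2 ∣ q ^ 2 - 1 := (Nat.gcd_dvd_left _ _).trans (Nat.gcd_dvd_left _ _)
    have g2 : e1.gcd e2 ∣ q ^ 2 + 1 := (Nat.gcd_dvd_right _ _).trans (Nat.gcd_dvd_left _ _)
    have h3 : e1.gcd e2 ∣ 2 := by
      have : q ^ 2 + 1 = (q ^ 2 - 1) + 2 := by omega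
      rw [this] at g2
      exact (Nat.dvd_add_right g1).1 g2
    have h4 : Odd (e1.gcd e2) := (hao.mul hbo).of_dvd_nat
      ((Nat.gcd_dvd_left _ _).trans (Nat.gcd_dvd_right _ _))
    rcases (Nat.dvd_prime Nat.prime_two).1 h3 with h | h
    · exact h
    · rw [h] at h4; exact absurd h4 (by decide)
  have hcases : ∀ n : ℕ, ¬ (a * b ∣ n) → n.gcd (a * b) = 1 ∨ n.gcd (a * b) = a ∨
      n.gcd (a * b) = b := by
    intro n hn
    have h1 := Nat.gcd_dvd_right n (a * b)
    obtain ⟨x, y, hx, hy, hxy⟩ := (Nat.dvd_mul).1 h1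
    rcases (Nat.dvd_prime ha).1 hx with rfl | rfl <;> rcases (Nat.dvd_prime hb).1 hy with rfl | rfl
    · left; simpa using hxy.symm
    · right; right; simpa using hxy.symm
    · right; left; simpa using hxy.symm
    · exact absurd (hxy ▸ Nat.gcd_dvd_left _ _) hn
  have ha3 : 3 ≤ a := by
    have := ha.two_le; rcases hao with ⟨c, hc⟩; omega
  have hb3 : 3 ≤ b := by
    have := hb.two_le; rcases hbo with ⟨c, hc⟩; omega
  have hle : e1 + e2 ≤ a + b := by
    rcases hcases _ hcon.1 with h | h | h <;> rcases hcases _ hcon.2 with h' | h' | h' <;>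
      rw [← he1] at h <;> rw [← he2] at h' <;> rw [h, h'] at hcop ⊢ <;> try omega
    · rw [Nat.coprime_self] at hcop; omega
    · rw [Nat.coprime_self] at hcop; omega
  have hfin : 2 * ((a : ℤ) * b - 1) ≤ 3 * (e1 + e2) := by
    have hq0 : (0 : ℤ) < q := by exact_mod_cast (by omega : 0 < q)
    refine le_of_mul_le_mul_right ?_ hq0
    push_cast at hc
    linarith
  have hle' : (e1 : ℤ) + e2 ≤ a + b := by exact_mod_cast hle
  have h5 : 5 ≤ a ∨ 5 ≤ b := by
    rcases hao with ⟨c, hc⟩; rcases hbo with ⟨c', hc'⟩; omega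
  have ha3' : (3 : ℤ) ≤ a := by exact_mod_cast ha3
  have hb3' : (3 : ℤ) ≤ b := by exact_mod_cast hb3
  rcases h5 with h | h
  · have : (5 : ℤ) ≤ a := by exact_mod_cast h
    nlinarith
  · have : (5 : ℤ) ≤ b := by exact_mod_cast h
    nlinarith

lemma monic_finite (k : Type) [Field k] [Fintype k] (n : ℕ) :
    {h : k[X] | h.Monic ∧ h.natDegree = n}.Finite := by
  have e := (monicEquivDegreeLT (R := k) n).trans (degreeLTEquiv k n).toEquiv
  exact Finite.of_equiv _ e.symm

/-- Monic polynomials of degree `n`. -/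
noncomputable def mon (k : Type) [Field k] [Fintype k] (n : ℕ) : Finset k[X] :=
  (monic_finite k n).toFinset

lemma mem_mon (k : Type) [Field k] [Fintype k] (n : ℕ) (h : k[X]) :
    h ∈ mon k n ↔ h.Monic ∧ h.natDegree = n := by
  simp [mon]

/-- The multiplicative function on polynomials attached to `y^2 = x^3 + x`. -/
noncomputable def lam (k : Type) [Field k] [Fintype k] (i : k) (h : k[X]) : ℤ :=
  qc k (h.eval 0 * h.eval i * h.eval (-i))

lemma lam_mul (k : Type) [Field k] [Fintype k] (i : k) (g h : k[X]) :
    lam k i (g * h) = lam k i g * lam k i h := by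
  unfold lam
  rw [← map_mul]
  congr 1
  simp only [eval_mul]
  ring

lemma lam_pow (k : Type) [Field k] [Fintype k] (i : k) (g : k[X]) (n : ℕ) :
    lam k i (g ^ n) = lam k i g ^ n := by
  induction n with
  | zero => simp [lam]
  | succ n ih => rw [pow_succ, lam_mul, ih, pow_succ]

/-- Coefficients of the L-function. -/
noncomputable def cL (k : Type) [Field k] [Fintype k] (i : k) (n : ℕ) : ℤ :=
  ∑ h ∈ mon k n, lam k i h

lemma cL_zero (k : Type) [Field k] [Fintype k] (i : k) : cL k i 0 = 1 := by
  have : mon k 0 = {1} := by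
    ext h
    rw [mem_mon, Finset.mem_singleton]
    constructor
    · rintro ⟨h1, h2⟩; exact eq_one_of_monic_natDegree_zero h1 h2
    · rintro rfl; simp
  unfold cL
  rw [this]
  simp [lam]

lemma cL_one (k : Type) [Field k] [Fintype k] (i : k) (hi : i ^ 2 = -1) :
    cL k i 1 = eSum k := by
  unfold cL eSum
  symm
  refine Finset.sum_bij (fun a _ => X + C a) ?_ ?_ ?_ ?_
  · intro a _
    rw [mem_mon]
    exact ⟨monic_X_add_C a, natDegree_X_add_C a⟩
  · intro a _ b _ h
    simpa using h
  · intro h hh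
    rw [mem_mon] at hh
    exact ⟨h.coeff 0, Finset.mem_univ _, (hh.1.eq_X_add_C hh.2).symm⟩
  · intro a _
    unfold lam
    congr 1
    simp
    linear_combination (a) * hi

lemma cL_big (k : Type) [Field k] [Fintype k] (hk : ringChar k ≠ 2) (i : k) (hi : i ^ 2 = -1)
    (n : ℕ) (hn : 3 ≤ n) : cL k i n = 0 := by
  have hdeg : ∀ a : k, (C a * (X ^ 2 + 1) : k[X]).natDegree < n := by
    intro a
    refine lt_of_le_of_lt (natDegree_C_mul_le _ _) (lt_of_le_of_lt (b := 2) ?_ (by omega))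
    compute_degree
  have hmem : ∀ a : k, ∀ h ∈ mon k n, h + C a * (X ^ 2 + 1) ∈ mon k n := by
    intro a h hh
    rw [mem_mon] at hh ⊢
    have hd : (C a * (X ^ 2 + 1) : k[X]).degree < h.degree := by
      rw [degree_eq_natDegree hh.1.ne_zero, hh.2]
      exact (degree_le_natDegree).trans_lt (by exact_mod_cast hdeg a)
    exact ⟨hh.1.add_of_left hd, by rw [natDegree_add_eq_left_of_degree_lt hd, hh.2]⟩
  have h1 : ∀ a : k, ∑ h ∈ mon k n, lam k i (h + C a * (X ^ 2 + 1)) = cL k i n := by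
    intro a
    refine Finset.sum_bij (fun h _ => h + C a * (X ^ 2 + 1)) (hmem a) ?_ ?_ ?_
    · intro g _ h _ hgh; exact add_right_cancel hgh
    · intro h hh
      refine ⟨h + C (-a) * (X ^ 2 + 1), hmem (-a) h hh, ?_⟩
      simp
    · intro h _; rfl
  have h2 : ∑ a : k, ∑ h ∈ mon k n, lam k i (h + C a * (X ^ 2 + 1)) = 0 := by
    rw [Finset.sum_comm]
    refine Finset.sum_eq_zero fun h _ => ?_
    have : ∀ a : k, lam k i (h + C a * (X ^ 2 + 1)) =
        qc k (h.eval 0 + a) * (qc k (h.eval i) * qc k (h.eval (-i))) := by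
      intro a
      unfold lam
      rw [map_mul, map_mul, mul_assoc]
      congr 2
      · simp
      · simp [hi]
      · simp [hi]
    simp_rw [this]
    rw [← Finset.sum_mul, Fintype.sum_equiv (Equiv.addLeft (h.eval 0)) (fun a => qc k (h.eval 0 + a)) (fun a => qc k a)
      (fun _ => rfl), qc_sum_zero k hk, zero_mul]
  simp_rw [h1] at h2
  simpa using h2

lemma qc_neg_one (k : Type) [Field k] [Fintype k] (i : k) (hi : i ^ 2 = -1) :
    qc k (-1) = 1 := by
  have : i ≠ 0 := by rintro rfl; simp at hi
  rw [← hi, sq, map_mul, qc_sq k this]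

lemma sum_two_sq (k : Type) [Field k] [Fintype k] (hk : ringChar k ≠ 2) (i : k)
    (hi : i ^ 2 = -1) (c : k) (hc : c ≠ 0) :
    ∑ a : k, qc k (c + a * i) * qc k (c - a * i) = -1 := by
  classical
  have hi0 : i ≠ 0 := by rintro rfl; simp at hi
  have h2 : (2 : k) ≠ 0 := Ring.two_ne_zero hk
  have e1 : ∑ a : k, qc k (c + a * i) * qc k (c - a * i) =
      ∑ u : k, qc k u * qc k (2 * c - u) := by
    refine Fintype.sum_bijective (fun a => c + a * i) ?_ _ _ ?_
    · rw [← Finite.injective_iff_bijective]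
      intro a b h
      exact mul_right_cancel₀ hi0 (add_left_cancel h)
    · intro a
      congr 2
      ring
  have e2 : ∑ u : k, qc k u * qc k (2 * c - u) =
      ∑ w ∈ Finset.univ.erase (0 : k), qc k (2 * c * w - 1) := by
    rw [← Finset.sum_subset (Finset.subset_univ (Finset.univ.erase (0 : k)))]
    · refine Finset.sum_bij (fun u _ => u⁻¹) ?_ ?_ ?_ ?_
      · intro u hu; simpa using hu
      · intro u _ v _ h; exact inv_injective h
      · intro u hu
        exact ⟨u⁻¹, by simpa using hu, inv_inv u⟩
      · intro u hu
        have hu0 : u ≠ 0 := by simpa using hu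
        have : 2 * c - u = u * (2 * c * u⁻¹ - 1) := by field_simp
        rw [this, map_mul, ← mul_assoc, qc_sq k hu0, one_mul]
    · intro x _ hx
      have : x = 0 := by simpa using hx
      subst this
      simp [MulChar.map_zero]
  have e3 : ∑ w : k, qc k (2 * c * w - 1) = 0 := by
    rw [← qc_sum_zero k hk]
    refine Fintype.sum_bijective (fun w => 2 * c * w - 1) ?_ _ _ (fun _ => rfl)
    rw [← Finite.injective_iff_bijective]
    intro a b h
    exact mul_left_cancel₀ (mul_ne_zero h2 hc) (sub_left_injective h)
  have e4 := Finset.add_sum_erase Finset.univ (fun w => qc k (2 * c * w - 1)) (Finset.mem_univ (0 : k))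
  rw [e3] at e4
  rw [e1, e2]
  simp only [mul_zero, zero_sub, qc_neg_one k i hi] at e4
  linarith

lemma cL_two (k : Type) [Field k] [Fintype k] (hk : ringChar k ≠ 2) (i : k) (hi : i ^ 2 = -1) :
    cL k i 2 = Fintype.card k := by
  classical
  have hi0 : i ≠ 0 := by rintro rfl; simp at hi
  have e1 : cL k i 2 = ∑ z : k × k, qc k z.1 *
      (qc k ((z.1 - 1) + z.2 * i) * qc k ((z.1 - 1) - z.2 * i)) := by
    unfold cL
    symm
    refine Finset.sum_bij (fun z _ => X ^ 2 + C z.2 * X + C z.1) ?_ ?_ ?_ ?_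
    · intro z _
      rw [mem_mon]
      constructor
      · monicity!
      · compute_degree!
    · intro z _ w _ h
      have h0 := congrArg (fun f => coeff f 0) h
      have h1 := congrArg (fun f => coeff f 1) h
      simp [coeff_X, coeff_C] at h0 h1
      exact Prod.ext h0 h1
    · intro h hh
      rw [mem_mon] at hh
      refine ⟨(h.coeff 0, h.coeff 1), Finset.mem_univ _, ?_⟩
      have h2 : h.coeff 2 = 1 := by rw [← hh.2]; exact hh.1
      conv_rhs => rw [h.as_sum_range_C_mul_X_pow, hh.2]
      simp [Finset.sum_range_succ, h2]
      ring
    · intro z _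
      unfold lam
      rw [map_mul, map_mul, mul_assoc]
      congr 2
      · simp
      · congr 1; simp [hi]; ring
      · congr 1; simp [hi]; ring
  rw [e1, Fintype.sum_prod_type]
  simp_rw [← Finset.mul_sum]
  have e2 : ∀ b : k, qc k b * ∑ a : k, qc k ((b - 1) + a * i) * qc k ((b - 1) - a * i) =
      (if b = 1 then (Fintype.card k : ℤ) else 0) - qc k b := by
    intro b
    split_ifs with h
    · subst h
      have : ∀ a : k, qc k ((1 - 1) + a * i) * qc k ((1 - 1) - a * i) = if a = 0 then 0 else 1 := by
        intro a
        split_ifs with ha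
        · subst ha; simp [MulChar.map_zero]
        · rw [← map_mul]
          have : (1 - 1 + a * i) * (1 - 1 - a * i) = a * a := by linear_combination - a ^ 2 * hi
          rw [this, map_mul, qc_sq k ha]
      simp_rw [this]
      rw [map_one, one_mul, Finset.sum_ite]
      simp [Finset.filter_ne', Nat.cast_pred Fintype.card_pos]
    · rw [sum_two_sq k hk i hi (b - 1) (sub_ne_zero.2 h)]
      ring
  simp_rw [e2]
  rw [Finset.sum_sub_distrib, qc_sum_zero k hk]
  simp

/-- Monic irreducible polynomials of degree at most `N`. -/
noncomputable def irr (k : Type) [Field k] [Fintype k] (N : ℕ) : Finset k[X] := by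
  classical
  exact ((Finset.range (N + 1)).biUnion (mon k)).filter Irreducible

lemma mem_irr (k : Type) [Field k] [Fintype k] (N : ℕ) (P : k[X]) :
    P ∈ irr k N ↔ P.Monic ∧ P.natDegree ≤ N ∧ Irreducible P := by
  classical
  unfold irr
  simp only [Finset.mem_filter, Finset.mem_biUnion, Finset.mem_range, mem_mon]
  constructor
  · rintro ⟨⟨a, h1, h2, h3⟩, h4⟩; exact ⟨h2, by omega, h4⟩
  · rintro ⟨h1, h2, h3⟩; exact ⟨⟨_, by omega, h1, rfl⟩, h3⟩

/-- Power sums defined through irreducible polynomials. -/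
noncomputable def sP (k : Type) [Field k] [Fintype k] (i : k) (N j : ℕ) : ℤ :=
  ∑ P ∈ irr k N, if P.natDegree ∣ j then
    (P.natDegree : ℤ) * lam k i P ^ (j / P.natDegree) else 0

lemma degree_identity (k : Type) [Field k] [Fintype k] [DecidableEq k] [DecidableEq k[X]] (N n : ℕ) (hn : n ≤ N)
    (h : k[X]) (hh : h ∈ mon k n) :
    n = ∑ P ∈ irr k N, P.natDegree *
      (Multiset.count P (UniqueFactorizationMonoid.normalizedFactors h)) := by
  rw [mem_mon] at hh
  have hn0 := hh.1.ne_zero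
  have hmon : ∀ P ∈ UniqueFactorizationMonoid.normalizedFactors h, P.Monic := by
    intro P hP
    have h1 := UniqueFactorizationMonoid.normalize_normalized_factor P hP
    rw [← h1]
    exact monic_normalize (UniqueFactorizationMonoid.irreducible_of_normalized_factor P hP).ne_zero
  have hprod : (UniqueFactorizationMonoid.normalizedFactors h).prod = h := by
    rw [UniqueFactorizationMonoid.prod_normalizedFactors_eq hn0, hh.1.normalize_eq_self]
  have hdeg : n = ((UniqueFactorizationMonoid.normalizedFactors h).map natDegree).sum := by
    rw [← natDegree_multiset_prod_of_monic _ hmon, hprod, hh.2]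
  rw [Finset.sum_multiset_map_count] at hdeg
  rw [hdeg]
  have hsub : (UniqueFactorizationMonoid.normalizedFactors h).toFinset ⊆ irr k N := by
    intro P hP
    rw [Multiset.mem_toFinset] at hP
    rw [mem_irr]
    refine ⟨hmon P hP, ?_, UniqueFactorizationMonoid.irreducible_of_normalized_factor P hP⟩
    exact (natDegree_le_of_dvd (UniqueFactorizationMonoid.dvd_of_mem_normalizedFactors hP)
      hn0).trans (by omega)
  rw [← hdeg]
  rw [← Finset.sum_subset hsub]
  · rw [hdeg]
    refine Finset.sum_congr rfl fun P _ => ?_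
    rw [smul_eq_mul, mul_comm]
  · intro P _ hP
    rw [Multiset.mem_toFinset] at hP
    rw [Multiset.count_eq_zero_of_notMem hP, mul_zero]

lemma count_identity (k : Type) [Field k] [Fintype k] [DecidableEq k] [DecidableEq k[X]] (n : ℕ)
    (h : k[X]) (hh : h ∈ mon k n) (P : k[X]) (hP : Irreducible P) (hPm : P.Monic)
    [DecidablePred (fun j => P.natDegree ∣ j ∧ P ^ (j / P.natDegree) ∣ h)] :
    Multiset.count P (UniqueFactorizationMonoid.normalizedFactors h) =
      ((Finset.Icc 1 n).filter (fun j => P.natDegree ∣ j ∧ P ^ (j / P.natDegree) ∣ h)).card := by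
  rw [mem_mon] at hh
  have hn0 := hh.1.ne_zero
  set m := Multiset.count P (UniqueFactorizationMonoid.normalizedFactors h) with hm
  have hmul : emultiplicity P h = m := by
    rw [UniqueFactorizationMonoid.emultiplicity_eq_count_normalizedFactors hP hn0,
      hPm.normalize_eq_self]
  have hdvd : ∀ r, P ^ r ∣ h ↔ r ≤ m := by
    intro r
    rw [pow_dvd_iff_le_emultiplicity, hmul]
    exact_mod_cast Iff.rfl
  have hpos : 0 < P.natDegree := hP.natDegree_pos
  have : (Finset.Icc 1 n).filter (fun j => P.natDegree ∣ j ∧ P ^ (j / P.natDegree) ∣ h) =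
      (Finset.Icc 1 m).image (fun r => P.natDegree * r) := by
    ext j
    simp only [Finset.mem_filter, Finset.mem_Icc, Finset.mem_image, hdvd]
    constructor
    · rintro ⟨⟨h1, h2⟩, ⟨r, rfl⟩, h4⟩
      rw [Nat.mul_div_cancel_left _ hpos] at h4
      refine ⟨r, ⟨?_, h4⟩, rfl⟩
      rcases Nat.eq_zero_or_pos r with h | h
      · subst h; omega
      · exact h
    · rintro ⟨r, ⟨h1, h2⟩, rfl⟩
      rw [Nat.mul_div_cancel_left _ hpos]
      refine ⟨⟨Nat.mul_pos hpos h1, ?_⟩, dvd_mul_right _ _, h2⟩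
      have := natDegree_le_of_dvd ((hdvd r).2 h2) hn0
      rw [natDegree_pow, hh.2] at this
      linarith [mul_comm r P.natDegree]
  rw [this, Finset.card_image_of_injective, Nat.card_Icc]
  · simp
  · intro a b hab
    exact Nat.eq_of_mul_eq_mul_left hpos hab

lemma sum_multiples (k : Type) [Field k] [Fintype k] [DecidableEq k[X]] (i : k) (n j : ℕ)
    (hjn : j ≤ n) (Q : k[X]) (hQ : Q ∈ mon k j) [DecidablePred (fun h : k[X] => Q ∣ h)] :
    ∑ h ∈ (mon k n).filter (fun h => Q ∣ h), lam k i h = lam k i Q * cL k i (n - j) := by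
  rw [mem_mon] at hQ
  unfold cL
  rw [Finset.mul_sum]
  symm
  refine Finset.sum_bij (fun g _ => Q * g) ?_ ?_ ?_ ?_
  · intro g hg
    rw [mem_mon] at hg
    rw [Finset.mem_filter, mem_mon]
    refine ⟨⟨hQ.1.mul hg.1, ?_⟩, dvd_mul_right _ _⟩
    rw [hQ.1.natDegree_mul hg.1, hQ.2, hg.2]; omega
  · intro a _ b _ hab
    exact mul_left_cancel₀ hQ.1.ne_zero hab
  · intro h hh
    rw [Finset.mem_filter, mem_mon] at hh
    obtain ⟨⟨h1, h2⟩, g, rfl⟩ := hh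
    have hg : g.Monic := hQ.1.of_mul_monic_left h1
    refine ⟨g, ?_, rfl⟩
    rw [mem_mon]
    rw [hQ.1.natDegree_mul hg, hQ.2] at h2
    exact ⟨hg, by omega⟩
  · intro g _
    rw [lam_mul]

lemma newton (k : Type) [Field k] [Fintype k] (i : k) (N n : ℕ) (hn : n ≤ N) :
    (n : ℤ) * cL k i n = ∑ j ∈ Finset.Icc 1 n, sP k i N j * cL k i (n - j) := by
  classical
  have e1 : (n : ℤ) * cL k i n = ∑ h ∈ mon k n, ∑ P ∈ irr k N, ∑ j ∈ Finset.Icc 1 n,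
      if P.natDegree ∣ j ∧ P ^ (j / P.natDegree) ∣ h then (P.natDegree : ℤ) * lam k i h else 0 := by
    unfold cL
    rw [Finset.mul_sum]
    refine Finset.sum_congr rfl fun h hh => ?_
    have := degree_identity k N n hn h hh
    conv_lhs => rw [this]
    push_cast
    rw [Finset.sum_mul]
    refine Finset.sum_congr rfl fun P hP => ?_
    rw [mem_irr] at hP
    rw [count_identity k n h hh P hP.2.2 hP.1, ← Finset.sum_filter, Finset.sum_const, nsmul_eq_mul]
    ring
  have e2 : ∀ P ∈ irr k N, ∀ j ∈ Finset.Icc 1 n, (∑ h ∈ mon k n,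
      if P.natDegree ∣ j ∧ P ^ (j / P.natDegree) ∣ h then (P.natDegree : ℤ) * lam k i h else 0) =
      (if P.natDegree ∣ j then (P.natDegree : ℤ) * lam k i P ^ (j / P.natDegree) else 0) *
        cL k i (n - j) := by
    intro P hP j hj
    rw [mem_irr] at hP
    rw [Finset.mem_Icc] at hj
    split_ifs with hd
    · simp only [hd, true_and]
      rw [← Finset.sum_filter, ← Finset.mul_sum, sum_multiples k i n j hj.2, lam_pow, mul_assoc]
      rw [mem_mon]
      exact ⟨hP.1.pow _, by rw [natDegree_pow, Nat.div_mul_cancel hd]⟩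
    · simp [hd]
  rw [e1, Finset.sum_comm]
  simp_rw [Finset.sum_comm (s := mon k n)]
  rw [Finset.sum_comm]
  refine Finset.sum_congr rfl fun j hj => ?_
  unfold sP
  rw [Finset.sum_mul]
  exact Finset.sum_congr rfl fun P hP => e2 P hP j hj

lemma qc_pow (F : Type) [Field F] [Fintype F] (hF : ringChar F ≠ 2) (a : F) :
    ((qc F a : ℤ) : F) = a ^ (Fintype.card F / 2) :=
  @quadraticChar_eq_pow_of_char_ne_two' F _ _ (Classical.decEq F) hF a

lemma qc_cases (F : Type) [Field F] [Fintype F] (a : F) (ha : a ≠ 0) :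
    qc F a = 1 ∨ qc F a = -1 :=
  mul_self_eq_one_iff.1 (qc_sq F ha)

lemma ringChar_ext (k F : Type) [Field k] [Field F] [Algebra k F] (hk : ringChar k ≠ 2) :
    ringChar F ≠ 2 := by
  intro h
  apply hk
  have h2 : ((2 : ℕ) : F) = 0 := by rw [← h]; exact ringChar.Nat.cast_ringChar
  have : ((2 : ℕ) : k) = 0 := by
    apply (algebraMap k F).injective
    rw [map_natCast, h2, map_zero]
  have h3 := ringChar.dvd this
  exact (Nat.dvd_prime Nat.prime_two).1 h3 |>.resolve_left CharP.ringChar_ne_one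

lemma qc_norm (k F : Type) [Field k] [Field F] [Fintype k] [Fintype F] [Algebra k F]
    (hk : ringChar k ≠ 2) (y : F) : qc F y = qc k (Algebra.norm k y) := by
  have hF := ringChar_ext k F hk
  by_cases hy : y = 0
  · subst hy
    rw [Algebra.norm_zero, MulChar.map_zero, MulChar.map_zero]
  have hn : Algebra.norm k y ≠ 0 := Algebra.norm_ne_zero_iff.2 hy
  have key : ((qc F y : ℤ) : F) = ((qc k (Algebra.norm k y) : ℤ) : F) := by
    rw [qc_pow F hF, ← map_intCast (algebraMap k F), qc_pow k hk, map_pow,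
      FiniteField.algebraMap_norm_eq_pow, ← pow_mul]
    congr 1
    rw [Nat.card_eq_fintype_card, Nat.card_eq_fintype_card]
    have c1 : Fintype.card F = Fintype.card k ^ Module.finrank k F := Module.card_eq_pow_finrank
    have hd : Fintype.card k - 1 ∣ Fintype.card F - 1 := by
      rw [c1]
      simpa using Nat.sub_dvd_pow_sub_pow (Fintype.card k) 1 (Module.finrank k F)
    have o1 := FiniteField.odd_card_of_char_ne_two hF
    have o2 := FiniteField.odd_card_of_char_ne_two hk
    have g2 : 1 < Fintype.card k := Fintype.one_lt_card
    obtain ⟨c, hc⟩ := hd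
    obtain ⟨a, ha⟩ : ∃ a, Fintype.card k = 2 * a + 1 := ⟨Fintype.card k / 2, by omega⟩
    rw [ha] at hc ⊢
    rw [Nat.add_sub_cancel] at hc ⊢
    have ha0 : 0 < 2 * a := by omega
    rw [hc, Nat.mul_div_cancel_left _ ha0]
    have h1 : Fintype.card F = 2 * (a * c) + 1 := by
      have : 2 * a * c = 2 * (a * c) := by ring
      omega
    rw [h1, show (2 * (a * c) + 1) / 2 = a * c by omega, show (2 * a + 1) / 2 = a by omega, mul_comm]
  have hne : (1 : F) ≠ -1 := (Ring.neg_one_ne_one_of_char_ne_two hF).symm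
  rcases qc_cases F y hy with h1 | h1 <;> rcases qc_cases k _ hn with h2 | h2 <;>
    rw [h1, h2] at key ⊢ <;> exfalso <;> push_cast at key
  · exact hne key
  · exact hne key.symm

lemma qc_neg (k : Type) [Field k] [Fintype k] (i : k) (hi : i ^ 2 = -1) (n : ℕ) (a : k) :
    qc k ((-1) ^ n * a) = qc k a := by
  rw [map_mul, map_pow, qc_neg_one k i hi, one_pow, one_mul]

lemma qc_minpoly (k F : Type) [Field k] [Field F] [Fintype k] [Fintype F] [Algebra k F]
    (hk : ringChar k ≠ 2) (i : k) (hi : i ^ 2 = -1) (y : F) :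
    qc F y = qc k ((minpoly k y).eval 0) ^ (Module.finrank k F / (minpoly k y).natDegree) := by
  have hyint : IsIntegral k y := Algebra.IsIntegral.isIntegral y
  rw [qc_norm k F hk, Algebra.norm_eq_norm_adjoin, map_pow]
  have h1 : Algebra.norm k (IntermediateField.AdjoinSimple.gen k y) =
      (-1) ^ (minpoly k y).natDegree * (minpoly k y).eval 0 := by
    have := Algebra.PowerBasis.norm_gen_eq_coeff_zero_minpoly
      (IntermediateField.adjoin.powerBasis hyint)
    rw [IntermediateField.adjoin.powerBasis_gen, IntermediateField.adjoin.powerBasis_dim,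
      IntermediateField.minpoly_gen] at this
    rw [this, coeff_zero_eq_eval_zero]
  rw [h1, qc_neg k i hi]
  congr 1
  rw [← IntermediateField.adjoin.finrank hyint, ← Module.finrank_mul_finrank k
    (IntermediateField.adjoin k {y}) F, Nat.mul_div_cancel_left]
  exact Module.finrank_pos

lemma qc_minpoly_sub (k F : Type) [Field k] [Field F] [Fintype k] [Fintype F] [Algebra k F]
    (hk : ringChar k ≠ 2) (i : k) (hi : i ^ 2 = -1) (x : F) (c : k) :
    qc F (x - algebraMap k F c) =
      qc k ((minpoly k x).eval c) ^ (Module.finrank k F / (minpoly k x).natDegree) := by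
  rw [qc_minpoly k F hk i hi, minpoly.sub_algebraMap, natDegree_comp, natDegree_X_add_C, mul_one,
    eval_comp]
  simp

lemma qc_cubic (k F : Type) [Field k] [Field F] [Fintype k] [Fintype F] [Algebra k F]
    (hk : ringChar k ≠ 2) (i : k) (hi : i ^ 2 = -1) (x : F) :
    qc F (x ^ 3 + x) =
      lam k i (minpoly k x) ^ (Module.finrank k F / (minpoly k x).natDegree) := by
  have hI : (algebraMap k F i) ^ 2 = -1 := by rw [← map_pow, hi, map_neg, map_one]
  have : x ^ 3 + x = (x - algebraMap k F 0) * (x - algebraMap k F i) * (x - algebraMap k F (-i)) := by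
    rw [map_zero, map_neg]
    linear_combination x * hI
  rw [this, map_mul, map_mul]
  simp only [qc_minpoly_sub k F hk i hi]
  unfold lam
  rw [map_mul, map_mul, mul_pow, mul_pow]

lemma card_minpoly (k F : Type) [Field k] [Field F] [Fintype k] [Fintype F] [Algebra k F]
    (P : k[X]) (hP : Irreducible P) (hPm : P.Monic) [DecidablePred (fun x : F => minpoly k x = P)] :
    (Finset.univ.filter (fun x : F => minpoly k x = P)).card =
      if P.natDegree ∣ Module.finrank k F then P.natDegree else 0 := by
  classical
  split_ifs with hd
  · rw [hP.natDegree_dvd_iff_dvd_X_pow_card_pow_sub_X] at hd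
    have hc : Nat.card k ^ Module.finrank k F = Fintype.card F := by
      rw [Nat.card_eq_fintype_card]; exact Module.card_eq_pow_finrank.symm
    rw [hc] at hd
    have hs : (map (algebraMap k F) P).Splits := by
      have h1 : (X ^ Fintype.card F - X : F[X]).Splits := by
        have := FiniteField.isSplittingField_sub F F
        simpa using this.splits
      refine h1.of_dvd ?_ ?_
      · exact FiniteField.X_pow_card_sub_X_ne_zero F Fintype.one_lt_card
      · have := Polynomial.map_dvd (algebraMap k F) hd
        simpa using this
    rw [← card_rootSet_eq_natDegree (PerfectField.separable_of_irreducible hP) hs,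
      ← Set.toFinset_card]
    congr 1
    ext x
    simp only [Finset.mem_filter, Finset.mem_univ, true_and, Set.mem_toFinset]
    rw [mem_rootSet]
    constructor
    · rintro rfl; exact ⟨hPm.ne_zero, minpoly.aeval k x⟩
    · rintro ⟨_, h⟩; exact (minpoly.eq_of_irreducible_of_monic hP h hPm).symm
  · rw [Finset.card_eq_zero, Finset.filter_eq_empty_iff]
    rintro x _ rfl
    exact hd (minpoly.degree_dvd (Algebra.IsIntegral.isIntegral x))

lemma eSum_ext (k F : Type) [Field k] [Field F] [Fintype k] [Fintype F] [Algebra k F]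
    (hk : ringChar k ≠ 2) (i : k) (hi : i ^ 2 = -1) (N : ℕ) (hN : Module.finrank k F ≤ N) :
    eSum F = sP k i N (Module.finrank k F) := by
  classical
  unfold eSum sP
  rw [← Finset.sum_fiberwise_of_maps_to (s := Finset.univ) (t := irr k N) (g := fun x : F => minpoly k x)]
  · refine Finset.sum_congr rfl fun P hP => ?_
    rw [mem_irr] at hP
    have h1 : ∀ x ∈ Finset.univ.filter (fun x : F => minpoly k x = P), qc F (x ^ 3 + x) =
        lam k i P ^ (Module.finrank k F / P.natDegree) := by
      intro x hx
      rw [Finset.mem_filter] at hx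
      rw [qc_cubic k F hk i hi, hx.2]
    rw [Finset.sum_congr rfl h1, Finset.sum_const, card_minpoly k F P hP.2.2 hP.1]
    split_ifs <;> simp
  · intro x _
    rw [mem_irr]
    have hx : IsIntegral k x := Algebra.IsIntegral.isIntegral x
    exact ⟨minpoly.monic hx, (minpoly.natDegree_le x).trans hN, minpoly.irreducible hx⟩

/-- The power sums satisfy the expected linear recursion. -/
lemma sP_rec (k : Type) [Field k] [Fintype k] (hk : ringChar k ≠ 2) (i : k) (hi : i ^ 2 = -1)
    (R : Type) [CommRing R] (α β : R) (hs : α + β = -((eSum k : ℤ) : R))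
    (hm : α * β = (Fintype.card k : R)) (N : ℕ) :
    ∀ n, 1 ≤ n → n ≤ N → ((sP k i N n : ℤ) : R) = -(α ^ n + β ^ n) := by
  intro n
  induction n using Nat.strong_induction_on with
  | _ n ih =>
    intro h1 hN
    have hnew := newton k i N n hN
    rcases Nat.lt_or_ge n 3 with h3 | h3
    · interval_cases n
      · simp [cL_one k i hi, cL_zero] at hnew
        rw [← hnew, pow_one, pow_one, hs, neg_neg]
      · rw [cL_two k hk i hi, show Finset.Icc 1 2 = {1, 2} by rfl, Finset.sum_pair (by norm_num),
          Nat.sub_self, cL_zero, show 2 - 1 = 1 by rfl, cL_one k i hi] at hnew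
        have e1 := ih 1 (by norm_num) le_rfl (by omega)
        have e2 := congrArg (Int.cast : ℤ → R) hnew
        push_cast at e2
        rw [e1] at e2
        rw [← hm] at e2
        linear_combination -e2 + (α + β) * hs
    · rw [cL_big k hk i hi n h3, mul_zero] at hnew
      have hsub : ({n, n - 1, n - 2} : Finset ℕ) ⊆ Finset.Icc 1 n := by
        intro x hx
        simp only [Finset.mem_insert, Finset.mem_singleton] at hx
        rw [Finset.mem_Icc]; omega
      rw [← Finset.sum_subset hsub] at hnew
      · rw [Finset.sum_insert, Finset.sum_insert, Finset.sum_singleton, Nat.sub_self, cL_zero,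
          show n - (n - 1) = 1 by omega, show n - (n - 2) = 2 by omega, cL_one k i hi,
          cL_two k hk i hi] at hnew
        · have e1 := ih (n - 1) (by omega) (by omega) (by omega)
          have e2 := ih (n - 2) (by omega) (by omega) (by omega)
          have e3 := congrArg (Int.cast : ℤ → R) hnew
          push_cast at e3
          rw [e1, e2, ← hm] at e3
          obtain ⟨r, rfl⟩ : ∃ r, n = r + 2 := ⟨n - 2, by omega⟩
          rw [show r + 2 - 1 = r + 1 by omega, show r + 2 - 2 = r by omega] at e3
          linear_combination -e3 + (α ^ (r + 1) + β ^ (r + 1)) * hs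
        · simp; omega
        · simp; omega
      · intro x hx hx2
        simp only [Finset.mem_insert, Finset.mem_singleton] at hx2
        rw [Finset.mem_Icc] at hx
        rw [cL_big k hk i hi (n - x) (by omega), mul_zero]

lemma val_eq (R : Type) [CommRing R] (hR : (1 : R) ≠ -1) (u : R) (a b : ℕ) (ha : 0 < a) (hb : 0 < b)
    (h1 : u ^ a = -1) (h2 : u ^ b = -1) : padicValNat 2 a = padicValNat 2 b := by
  haveI : Fact (Nat.Prime 2) := ⟨Nat.prime_two⟩
  have key : ∀ a b : ℕ, 0 < a → 0 < b → u ^ a = -1 → u ^ b = -1 →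
      ¬ padicValNat 2 a < padicValNat 2 b := by
    intro a b ha hb h1 h2 hlt
    obtain ⟨c, hc⟩ := pow_padicValNat_dvd (p := 2) (n := a)
    have hcodd : ¬ 2 ∣ c := by
      rintro ⟨e, rfl⟩
      refine pow_succ_padicValNat_not_dvd (p := 2) ha.ne' ⟨e, ?_⟩
      rw [pow_succ]; linarith
    have hd : 2 ^ (padicValNat 2 a + 1) ∣ b :=
      (pow_dvd_pow 2 hlt).trans pow_padicValNat_dvd
    obtain ⟨e, he⟩ := hd
    have o : Odd c := by rw [← Nat.not_even_iff_odd, even_iff_two_dvd]; exact hcodd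
    have e1 : u ^ (b * c) = -1 := by rw [pow_mul, h2, o.neg_one_pow]
    have e2 : u ^ (b * c) = 1 := by
      have : b * c = a * (2 * e) := by
        calc b * c = (2 ^ padicValNat 2 a * c) * (2 * e) := by
              conv_lhs => rw [he, pow_succ]
              ring
          _ = a * (2 * e) := by rw [← hc]
      rw [this, pow_mul, h1, pow_mul]; simp
    exact hR (e2.symm.trans e1)
  exact le_antisymm (not_lt.1 (key b a hb ha h2 h1)) (not_lt.1 (key a b ha hb h1 h2))

lemma exists_field (p : ℕ) [Fact p.Prime] (hp2 : p ≠ 2) (j : ℕ) (hj : 0 < j)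
    (hk : ringChar (GaloisField p 2) ≠ 2) [Fintype (GaloisField p 2)] (i : GaloisField p 2)
    (hi : i ^ 2 = -1) :
    ∃ (F : Type) (_ : Field F) (_ : Fintype F), ringChar F ≠ 2 ∧ Fintype.card F = (p ^ j) ^ 2 ∧
      eSum F = sP (GaloisField p 2) i j j := by
  haveI : NeZero j := ⟨hj.ne'⟩
  let F := FiniteField.Extension (GaloisField p 2) p j
  letI : Fintype F := Fintype.ofFinite F
  have hfr : Module.finrank (GaloisField p 2) F = j := FiniteField.finrank_extension _ p j
  refine ⟨F, inferInstance, inferInstance, ringChar_ext (GaloisField p 2) F hk, ?_, ?_⟩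
  · rw [← Nat.card_eq_fintype_card]
    have h := FiniteField.natCard_extension (GaloisField p 2) p j
    rw [GaloisField.card p 2 (by norm_num)] at h
    rw [← pow_mul, mul_comm, pow_mul]
    exact h
  · have := eSum_ext (GaloisField p 2) F hk i hi j hfr.le
    rw [hfr] at this
    exact this

lemma cong_step (p l : ℕ) [Fact p.Prime] [Fact l.Prime] (hp2 : p ≠ 2)
    (hpl : p ≠ l) :
    ∃ u : AlgebraicClosure (ZMod l), ∀ d j : ℕ, 0 < j → Odd d → l ∣ d → chebMaximal d (p ^ j) →
      (∀ (F : Type) [Field F] [Fintype F], ringChar F ≠ 2 → Fintype.card F = (p ^ j) ^ 2 →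
        d ∣ (p ^ j) ^ 2 - 1 ∨ d ∣ (p ^ j) ^ 2 + 1) → u ^ j = -1 := by
  have hpp : p.Prime := Fact.out
  letI : Fintype (GaloisField p 2) := Fintype.ofFinite _
  have hcard : Fintype.card (GaloisField p 2) = p ^ 2 := by
    rw [← Nat.card_eq_fintype_card, GaloisField.card p 2 (by norm_num)]
  have hk : ringChar (GaloisField p 2) ≠ 2 := by
    rw [ringChar.eq (GaloisField p 2) p]; exact hp2
  obtain ⟨i, hi⟩ : IsSquare (-1 : GaloisField p 2) := by
    rw [FiniteField.isSquare_neg_one_iff, hcard]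
    have : p % 4 = 0 ∨ p % 4 = 1 ∨ p % 4 = 2 ∨ p % 4 = 3 := by omega
    rcases this with h | h | h | h <;> simp [Nat.pow_mod, h]
  have hi2 : i ^ 2 = -1 := by rw [sq]; exact hi.symm
  set R := AlgebraicClosure (ZMod l) with hR
  set A : R := ((eSum (GaloisField p 2) : ℤ) : R) with hA
  obtain ⟨α, hα⟩ : ∃ α : R, α ^ 2 + A * α + (p : R) ^ 2 = 0 := by
    obtain ⟨α, h⟩ := IsAlgClosed.exists_root (X ^ 2 + C A * X + C ((p : R) ^ 2)) (by
      have : (X ^ 2 + C A * X + C ((p : R) ^ 2) : R[X]).degree = 2 := by compute_degree!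
      rw [this]; norm_num)
    refine ⟨α, ?_⟩
    simpa [IsRoot] using h
  set β : R := -A - α with hβ
  have hs : α + β = -A := by rw [hβ]; ring
  have hm : α * β = ((Fintype.card (GaloisField p 2) : ℕ) : R) := by
    rw [hcard]; push_cast; rw [hβ]; linear_combination -hα
  have hp0 : (p : R) ≠ 0 := by
    intro h
    rw [CharP.cast_eq_zero_iff R l] at h
    exact hpl ((Nat.prime_dvd_prime_iff_eq Fact.out hpp).1 h).symm
  refine ⟨α / (p : R) ^ 3, ?_⟩
  intro d j hj hd hld hmax hdiv
  obtain ⟨F, iF, iT, hF, hc, he⟩ := exists_field p hp2 j hj hk i hi2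
  have hrec := sP_rec (GaloisField p 2) hk i hi2 R α β hs hm j j hj le_rfl
  obtain ⟨c1, c2⟩ := cong_of_dvd F hF d (p ^ j) l hd hc hmax hld (hdiv F hF hc)
  rw [← he] at hrec
  have c1' : ((eSum F : ℤ) : R) = 2 * ((p : R) ^ j) ^ 3 := by
    have := congrArg (algebraMap (ZMod l) R) c1
    rw [map_mul, map_ofNat] at this
    simpa using this
  have c2' : ((p : R) ^ j) ^ 4 = 1 := by
    have := congrArg (algebraMap (ZMod l) R) c2
    simpa using this
  rw [c1'] at hrec
  have hprod : α ^ j * β ^ j = ((p : R) ^ j) ^ 2 := by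
    rw [← mul_pow, hm, hcard]; push_cast; rw [← pow_mul, ← pow_mul, mul_comm]
  set t : R := (p : R) ^ j with ht
  have hsq : (α ^ j + t ^ 3) ^ 2 = 0 := by
    linear_combination (α ^ j) * hrec - hprod + t ^ 2 * c2'
  have hz : α ^ j = - t ^ 3 := by
    have := pow_eq_zero_iff (two_ne_zero) |>.1 hsq
    linear_combination this
  have ht0 : t ≠ 0 := pow_ne_zero _ hp0
  rw [div_pow, hz, ht, pow_right_comm, neg_div, div_self (pow_ne_zero _ (pow_ne_zero _ hp0))]

lemma one_ne_neg (l : ℕ) [Fact l.Prime] (hl : Odd l) :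
    (1 : AlgebraicClosure (ZMod l)) ≠ -1 := by
  intro h
  have h2 : ((2 : ℕ) : AlgebraicClosure (ZMod l)) = 0 := by
    push_cast; linear_combination h
  rw [CharP.cast_eq_zero_iff _ l] at h2
  have := (Nat.prime_dvd_prime_iff_eq Fact.out Nat.prime_two).1 h2
  subst this
  exact absurd hl (by decide)

theorem statement17 (l₁ l₂ p : ℕ) (h1 : l₁.Prime) (h2 : l₂.Prime)
    (h1odd : Odd l₁) (h2odd : Odd l₂) (hne : l₁ ≠ l₂)
    (hp : p.Prime) (hcop : Nat.gcd p (2 * (l₁ * l₂)) = 1)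
    (m n : ℕ) (hm : 0 < m) (hn : 0 < n)
    (hmax1 : chebMaximal l₁ (p ^ m)) (hmax2 : chebMaximal l₂ (p ^ n))
    (k : ℕ) (hk : 0 < k) (hmax12 : chebMaximal (l₁ * l₂) (p ^ k)) :
    padicValNat 2 m = padicValNat 2 n := by
  haveI : Fact p.Prime := ⟨hp⟩
  haveI : Fact l₁.Prime := ⟨h1⟩
  haveI : Fact l₂.Prime := ⟨h2⟩
  have hnd : ¬ p ∣ 2 * (l₁ * l₂) := (Nat.Prime.coprime_iff_not_dvd hp).1 hcop
  have hp2 : p ≠ 2 := by rintro rfl; exact hnd (dvd_mul_right _ _)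
  have hp1 : p ≠ l₁ := by rintro rfl; exact hnd ((dvd_mul_right _ _).mul_left _)
  have hpl2 : p ≠ l₂ := by rintro rfl; exact hnd ((dvd_mul_left _ _).mul_left _)
  have hp3 : 3 ≤ p := by have := hp.two_le; omega
  have hq3 : 3 ≤ p ^ k := hp3.trans (Nat.le_self_pow hk.ne' p)
  have hprod : ∀ (F : Type) [Field F] [Fintype F], ringChar F ≠ 2 →
      Fintype.card F = (p ^ k) ^ 2 →
        l₁ * l₂ ∣ (p ^ k) ^ 2 - 1 ∨ l₁ * l₂ ∣ (p ^ k) ^ 2 + 1 := by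
    intro F _ _ hF hc
    exact prod_dvd F hF l₁ l₂ (p ^ k) h1 h2 h1odd h2odd hne hq3 hc hmax12
  obtain ⟨u, hu⟩ := cong_step p l₁ hp2 hp1
  obtain ⟨w, hw⟩ := cong_step p l₂ hp2 hpl2
  have u1 : u ^ m = -1 := hu l₁ m hm h1odd dvd_rfl hmax1
    (fun F _ _ hF hc => prime_dvd F hF l₁ (p ^ m) h1 hc hmax1)
  have u2 : u ^ k = -1 := hu _ k hk (h1odd.mul h2odd) (dvd_mul_right _ _) hmax12 hprod
  have w1 : w ^ n = -1 := hw l₂ n hn h2odd dvd_rfl hmax2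
    (fun F _ _ hF hc => prime_dvd F hF l₂ (p ^ n) h2 hc hmax2)
  have w2 : w ^ k = -1 := hw _ k hk (h1odd.mul h2odd) (dvd_mul_left _ _) hmax12 hprod
  exact (val_eq _ (one_ne_neg l₁ h1odd) u m k hm hk u1 u2).trans
    (val_eq _ (one_ne_neg l₂ h2odd) w k n hk hn w2 w1)
end

section
/- Let p be a prime and d ≥ 1 an integer, and let φ_d ∈ 𝔽_p[X] be the reduction modulo p of the d-th Chebyshev polynomial Φ_d. Then φ_d is a separable polynomial if and only if d = 1 or gcd(p, 2d) = 1 (i.e., p is odd and p does not divide d). -/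
open Polynomial

theorem deg_aux {R : Type*} [CommRing R] [IsDomain R] (k : ℕ) (a : R) (n : ℕ) :
    (dickson k a n).degree ≤ n ∧ (dickson k a (n + 1)).degree = ((n + 1 : ℕ) : WithBot ℕ) := by
  induction n with
  | zero =>
    refine ⟨?_, by simp⟩
    have h : (dickson k a 0) = C (3 - (k : R)) := by
      rw [dickson_zero, C_sub, C_ofNat, C_eq_natCast]
    rw [h]
    exact degree_C_le
  | succ n ih =>
    refine ⟨ih.2.le, ?_⟩
    have h1 : (X * dickson k a (n + 1)).degree = ((n + 1 + 1 : ℕ) : WithBot ℕ) := by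
      rw [degree_mul, ih.2, degree_X]; push_cast; ring
    have h2 : (C a * dickson k a n).degree ≤ (n : WithBot ℕ) := by
      refine (degree_mul_le _ _).trans ?_
      simpa using add_le_add (degree_C_le (a := a)) ih.1
    rw [dickson_add_two, degree_sub_eq_left_of_degree_lt, h1]
    rw [h1]
    refine h2.trans_lt ?_
    exact_mod_cast (by omega : n < n + 1 + 1)

theorem unit_aux {R : Type*} [CommRing R] [IsDomain R] (k : ℕ) (a : R) (n : ℕ)
    (h : IsUnit (dickson k a n)) : n = 0 := by
  cases n with
  | zero => rfl
  | succ n =>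
    have h1 := degree_eq_zero_of_isUnit h
    rw [(deg_aux k a n).2] at h1
    exact_mod_cast h1

theorem dickson_eq {R : Type*} [CommRing R] (n : ℕ) :
    dickson 1 (1 : R) (n + 1) = 2 * dickson 2 1 (n + 1) - X * dickson 2 1 n := by
  rw [dickson_one_one_eq_chebyshev_C, dickson_two_one_eq_chebyshev_S,
    dickson_two_one_eq_chebyshev_S, Chebyshev.C_eq_S_sub_X_mul_S]
  simp

theorem deriv_aux {R : Type*} [CommRing R] (n : ℕ) :
    derivative (dickson 1 (1 : R) (n + 1)) = (n + 1 : R[X]) * dickson 2 1 n ∧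
    derivative (dickson 1 (1 : R) (n + 2)) = (n + 2 : R[X]) * dickson 2 1 (n + 1) := by
  induction n with
  | zero =>
    constructor
    · simp; norm_num
    · simp; ring
  | succ n ih =>
    refine ⟨by rw [ih.2]; push_cast; ring, ?_⟩
    rw [dickson_add_two, derivative_sub, derivative_mul, derivative_X, C_1, one_mul, one_mul,
      ih.1, show n + 1 + 1 = n + 2 from rfl, ih.2, dickson_eq]
    simp only [dickson_add_two, C_1]
    push_cast
    ring

theorem pell_aux {R : Type*} [CommRing R] (n : ℕ) :
    dickson 1 (1 : R) (n + 1) ^ 2 - (X ^ 2 - 4) * dickson 2 1 n ^ 2 = 4 := by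
  have h := Chebyshev.S_sq_add_S_sq R n
  have e : ((n : ℤ) + 1) = ((n + 1 : ℕ) : ℤ) := by push_cast; rfl
  rw [e, ← dickson_two_one_eq_chebyshev_S, ← dickson_two_one_eq_chebyshev_S] at h
  rw [dickson_eq]
  linear_combination 4 * h

theorem statement19 (p d : ℕ) (hp : p.Prime) (hd : 1 ≤ d) :
    (dickson 1 (1 : ZMod p) d).Separable ↔ (d = 1 ∨ Nat.gcd p (2 * d) = 1) := by
  have : Fact p.Prime := ⟨hp⟩
  obtain ⟨n, rfl⟩ : ∃ n, d = n + 1 := ⟨d - 1, by omega⟩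
  have hder := (deriv_aux (R := ZMod p) n).1
  constructor
  · intro h
    by_contra! hc
    obtain ⟨h1, h2⟩ := hc
    have hdvd : p ∣ 2 * (n + 1) := by
      by_contra hnd
      exact h2 ((Nat.Prime.coprime_iff_not_dvd hp).2 hnd)
    rw [Separable, hder] at h
    rcases (Nat.Prime.dvd_mul hp).1 hdvd with h3 | h3
    · have h20 : (2 : (ZMod p)[X]) = 0 := by
        have : ((2 : ℕ) : ZMod p) = 0 := (ZMod.natCast_eq_zero_iff _ _).2 h3
        have h := congrArg (C : ZMod p → (ZMod p)[X]) this
        simpa only [Nat.cast_ofNat, C_ofNat, C_0] using h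
      have hu : IsUnit (dickson 2 (1 : ZMod p) n) := by
        refine h.isUnit_of_dvd' ?_ (Dvd.intro_left _ rfl)
        rw [dickson_eq, h20]
        exact ⟨-X, by ring⟩
      have := unit_aux _ _ _ hu
      omega
    · have h20 : (n + 1 : (ZMod p)[X]) = 0 := by
        have : ((n + 1 : ℕ) : ZMod p) = 0 := (ZMod.natCast_eq_zero_iff _ _).2 h3
        have h := congrArg (C : ZMod p → (ZMod p)[X]) this
        simpa using h
      rw [h20, zero_mul, isCoprime_zero_right] at h
      have := unit_aux _ _ _ h
      omega
  · rintro (h | h)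
    · rw [h, dickson_one]; exact separable_X
    · have hnd : ¬ p ∣ 2 * (n + 1) := (Nat.Prime.coprime_iff_not_dvd hp).1 h
      have h0 : ((2 * (n + 1) : ℕ) : ZMod p) ≠ 0 := fun hh =>
        hnd ((ZMod.natCast_eq_zero_iff _ _).1 hh)
      push_cast at h0
      have ha : (2 : ZMod p) ≠ 0 := left_ne_zero_of_mul h0
      have hb : ((n : ZMod p) + 1) ≠ 0 := right_ne_zero_of_mul h0
      have e1 : C (2⁻¹ : ZMod p) * 2 = 1 := by
        have := congrArg (C : ZMod p → (ZMod p)[X]) (inv_mul_cancel₀ ha)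
        simpa only [C_mul, C_1, C_ofNat] using this
      have e2 : C ((n + 1 : ZMod p)⁻¹) * (n + 1) = 1 := by
        have := congrArg (C : ZMod p → (ZMod p)[X]) (inv_mul_cancel₀ hb)
        simpa only [C_mul, C_1, C_add, C_eq_natCast, map_natCast] using this
      rw [Separable, hder]
      refine ⟨C 2⁻¹ ^ 2 * dickson 1 1 (n + 1),
        - C 2⁻¹ ^ 2 * C ((n + 1 : ZMod p)⁻¹) * (X ^ 2 - 4) * dickson 2 1 n, ?_⟩
      have hP := pell_aux (R := ZMod p) n
      generalize C (2⁻¹ : ZMod p) = u at *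
      generalize C ((n + 1 : ZMod p)⁻¹) = v at *
      generalize dickson 1 (1 : ZMod p) (n + 1) = D at *
      generalize dickson 2 (1 : ZMod p) n = S at *
      linear_combination u ^ 2 * hP - u ^ 2 * (X ^ 2 - 4) * S ^ 2 * e2 + (u * 2 + 1) * e1
end
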